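/- If a temporal interaction network is a chain, then the greedy algorithm computes the maximum flow: val(g) = sup{val(x) : x a flow assignment}. -/

import Mathlib

noncomputable section
attribute [local instance] Classical.propDecidable

/-- A temporal interaction network over an ambient vertex type `ν` and an
ambient interaction-index type `ι`: a finite vertex set `V`, a finite
interaction set `I`, a distinguished source `s` and sink `t`, and, for each
interaction, a source vertex, a destination vertex, a timestamp and a
quantity. -/
structure TIN (ν ι : Type) where
  V : Finset ν
  I : Finset ι
  s : ν
  t : ν
  src : ι → ν
  dest : ι → ν
  τ : ι → ℝ
  q : ι → ℝ

namespace TIN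

variable {ν ι : Type}

/-- The axioms of a temporal interaction network: `s,t ∈ V` are distinct, every
interaction joins two distinct vertices of `V`, quantities are nonnegative,
distinct interactions have distinct timestamps, no interaction enters `s`
and no interaction leaves `t`. -/
def Valid (N : TIN ν ι) : Prop :=
  N.s ∈ N.V ∧ N.t ∈ N.V ∧ N.s ≠ N.t ∧
  (∀ i ∈ N.I, N.src i ∈ N.V ∧ N.dest i ∈ N.V ∧ N.dest i ≠ N.src i ∧
      0 ≤ N.q i ∧ N.dest i ≠ N.s ∧ N.src i ≠ N.t) ∧
  (∀ i ∈ N.I, ∀ j ∈ N.I, N.τ i = N.τ j → i = j)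

/-- A flow assignment: (i) `0 ≤ x i ≤ q i`; (ii) `x i = q i` when `src i = s`;
(iii) for `src i ≠ s`, `x i` is at most the quantity received by `src i`
strictly before time `τ i` minus the quantity sent by `src i` strictly
before time `τ i`. -/
def IsFlow (N : TIN ν ι) (x : ι → ℝ) : Prop :=
  (∀ i ∈ N.I, 0 ≤ x i ∧ x i ≤ N.q i) ∧
  (∀ i ∈ N.I, N.src i = N.s → x i = N.q i) ∧
  (∀ i ∈ N.I, N.src i ≠ N.s →
    x i ≤ (∑ j ∈ N.I.filter fun j => N.dest j = N.src i ∧ N.τ j < N.τ i, x j)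
        - (∑ j ∈ N.I.filter fun j => N.src j = N.src i ∧ N.τ j < N.τ i, x j))

/-- The value of an assignment: the total quantity arriving at the sink. -/
def val (N : TIN ν ι) (x : ι → ℝ) : ℝ :=
  ∑ i ∈ N.I.filter fun i => N.dest i = N.t, x i

/-- The maximum flow: the supremum of the values of all flow assignments. -/
def maxFlow (N : TIN ν ι) : ℝ :=
  sSup {r : ℝ | ∃ x, N.IsFlow x ∧ N.val x = r}

/-- One step of the greedy algorithm: the state consists of the assignment
built so far and the buffers; processing interaction `i` transfers the
maximal possible amount from the buffer of `src i` to the buffer of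
`dest i` (the source `s` having unlimited supply). -/
def greedyStep (N : TIN ν ι) (gB : (ι → ℝ) × (ν → ℝ)) (i : ι) : (ι → ℝ) × (ν → ℝ) :=
  let amt : ℝ := if N.src i = N.s then N.q i else min (N.q i) (gB.2 (N.src i))
  (Function.update gB.1 i amt,
   fun v => gB.2 v + (if v = N.dest i then amt else 0)
          - (if v = N.src i ∧ N.src i ≠ N.s then amt else 0))

/-- The interactions listed in increasing order of timestamp. -/
def sortedI (N : TIN ν ι) : List ι :=
  N.I.toList.mergeSort fun a b => decide (N.τ a ≤ N.τ b)

/-- The greedy assignment: process the interactions in increasing order of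
timestamp, starting with all buffers at `0`. -/
def greedy (N : TIN ν ι) : ι → ℝ :=
  (N.sortedI.foldl N.greedyStep (fun _ => 0, fun _ => 0)).1

end TIN

/-- The network is a chain: `V = {v 0, …, v k}` with `k ≥ 1`, `v 0 = s`,
`v k = t`, the vertices `v 0, …, v k` pairwise distinct, and every interaction
goes from some `v j` to `v (j+1)` with `j < k`. -/
def TIN.IsChainNet {ν ι : Type} (N : TIN ν ι) : Prop :=
  ∃ k : ℕ, 1 ≤ k ∧ ∃ v : ℕ → ν,
    (∀ a ≤ k, ∀ b ≤ k, v a = v b → a = b) ∧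
    v 0 = N.s ∧ v k = N.t ∧
    (∀ j ≤ k, v j ∈ N.V) ∧ (∀ w ∈ N.V, ∃ j ≤ k, v j = w) ∧
    ∀ i ∈ N.I, ∃ j < k, N.src i = v j ∧ N.dest i = v (j + 1)

namespace TIN

variable {ν ι : Type}

/-- The network `N` with its interactions replaced by those in `P`. -/
def restrict (N : TIN ν ι) (P : Finset ι) : TIN ν ι := { N with I := P }

/-- The total quantity that `x` sends into `v` along the interactions in `P`. -/
def inflow (N : TIN ν ι) (P : Finset ι) (x : ι → ℝ) (v : ν) : ℝ :=
  ∑ j ∈ P with N.dest j = v, x j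

/-- The total quantity that `x` sends out of `v` along the interactions in `P`. -/
def outflow (N : TIN ν ι) (P : Finset ι) (x : ι → ℝ) (v : ν) : ℝ :=
  ∑ j ∈ P with N.src j = v, x j

variable {N : TIN ν ι} {P : Finset ι} {i : ι} {x y : ι → ℝ}

theorem inflow_insert (hi : i ∉ P) (v : ν) :
    N.inflow (insert i P) x v = (if N.dest i = v then x i else 0) + N.inflow P x v := by
  simp only [inflow, Finset.sum_filter, Finset.sum_insert hi]

theorem outflow_insert (hi : i ∉ P) (v : ν) :
    N.outflow (insert i P) x v = (if N.src i = v then x i else 0) + N.outflow P x v := by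
  simp only [outflow, Finset.sum_filter, Finset.sum_insert hi]

theorem inflow_congr (h : ∀ j ∈ P, x j = y j) (v : ν) : N.inflow P x v = N.inflow P y v :=
  Finset.sum_congr rfl fun j hj => h j (Finset.mem_filter.1 hj).1

theorem outflow_congr (h : ∀ j ∈ P, x j = y j) (v : ν) : N.outflow P x v = N.outflow P y v :=
  Finset.sum_congr rfl fun j hj => h j (Finset.mem_filter.1 hj).1

theorem isFlow_restrict : (N.restrict P).IsFlow x ↔
    (∀ i ∈ P, 0 ≤ x i ∧ x i ≤ N.q i) ∧
    (∀ i ∈ P, N.src i = N.s → x i = N.q i) ∧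
    (∀ i ∈ P, N.src i ≠ N.s →
      x i ≤ (∑ j ∈ P with N.dest j = N.src i ∧ N.τ j < N.τ i, x j)
          - (∑ j ∈ P with N.src j = N.src i ∧ N.τ j < N.τ i, x j)) :=
  Iff.rfl

theorem IsFlow.congr (hx : (N.restrict P).IsFlow x) (h : ∀ j ∈ P, x j = y j) :
    (N.restrict P).IsFlow y := by
  obtain ⟨hcap, hsrc, hbuf⟩ := hx
  refine ⟨fun j hj => h j hj ▸ hcap j hj, fun j hj => h j hj ▸ hsrc j hj, fun j hj hs => ?_⟩
  rw [← h j hj]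
  refine (hbuf j hj hs).trans_eq (congrArg₂ _ ?_ ?_) <;>
    exact Finset.sum_congr rfl fun l hl => h l (Finset.mem_filter.1 hl).1

/-- Adding an interaction later than all those of `P` only adds the constraints at that
interaction. -/
theorem isFlow_restrict_insert (hlt : ∀ j ∈ P, N.τ j < N.τ i) :
    (N.restrict (insert i P)).IsFlow x ↔ (N.restrict P).IsFlow x ∧
      (0 ≤ x i ∧ x i ≤ N.q i) ∧ (N.src i = N.s → x i = N.q i) ∧
      (N.src i ≠ N.s → x i ≤ N.inflow P x (N.src i) - N.outflow P x (N.src i)) := by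
  have hold : ∀ (p : ι → Prop), ∀ j ∈ P,
      ((insert i P).filter fun l => p l ∧ N.τ l < N.τ j) =
        P.filter fun l => p l ∧ N.τ l < N.τ j := by
    intro p j hj
    rw [Finset.filter_insert, if_neg fun h => (hlt j hj).asymm h.2]
  have hnew : ∀ (p : ι → Prop),
      ((insert i P).filter fun l => p l ∧ N.τ l < N.τ i) = P.filter p := by
    intro p
    rw [Finset.filter_insert, if_neg fun h => lt_irrefl _ h.2]
    exact Finset.filter_congr fun l hl => and_iff_left (hlt l hl)
  simp only [isFlow_restrict, Finset.forall_mem_insert, hnew, inflow, outflow]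
  have hsums : (∀ j ∈ P, N.src j ≠ N.s → x j ≤
        (∑ l ∈ insert i P with N.dest l = N.src j ∧ N.τ l < N.τ j, x l)
          - ∑ l ∈ insert i P with N.src l = N.src j ∧ N.τ l < N.τ j, x l) ↔
      ∀ j ∈ P, N.src j ≠ N.s → x j ≤
        (∑ l ∈ P with N.dest l = N.src j ∧ N.τ l < N.τ j, x l)
          - ∑ l ∈ P with N.src l = N.src j ∧ N.τ l < N.τ j, x l :=
    forall₂_congr fun j hj => by rw [hold _ j hj, hold _ j hj]
  rw [hsums]
  tauto

/-- What running the greedy algorithm through the interactions of `P` achieves: the buffers are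
nonnegative and record the net inflow, the assignment is a flow, and no flow brings more into
any vertex. -/
structure GreedyInvariant (N : TIN ν ι) (P : Finset ι) (gB : (ι → ℝ) × (ν → ℝ)) : Prop where
  buffer_eq : ∀ v, v ≠ N.s → gB.2 v = N.inflow P gB.1 v - N.outflow P gB.1 v
  buffer_nonneg : ∀ v, 0 ≤ gB.2 v
  isFlow : (N.restrict P).IsFlow gB.1
  inflow_le : ∀ x, (N.restrict P).IsFlow x → ∀ v, N.inflow P x v ≤ N.inflow P gB.1 v

/-- If two interactions share their source exactly when they share their destination, then
whatever enters the destination of `i` leaves the source of `i`. -/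
theorem outflow_src_eq_inflow_dest (h : ∀ j ∈ P, N.src j = N.src i ↔ N.dest j = N.dest i) :
    N.outflow P x (N.src i) = N.inflow P x (N.dest i) :=
  congrArg (fun Q : Finset ι => ∑ j ∈ Q, x j) (Finset.filter_congr h)

theorem GreedyInvariant.step {gB : (ι → ℝ) × (ν → ℝ)} (h : N.GreedyInvariant P gB)
    (hq : 0 ≤ N.q i) (hlt : ∀ j ∈ P, N.τ j < N.τ i)
    (hpar : ∀ j ∈ P, N.src j = N.src i ↔ N.dest j = N.dest i) :
    N.GreedyInvariant (insert i P) (N.greedyStep gB i) := by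
  obtain ⟨hB, hB0, hflow, hle⟩ := h
  have hi : i ∉ P := fun hmem => lt_irrefl _ (hlt i hmem)
  set amt : ℝ := if N.src i = N.s then N.q i else min (N.q i) (gB.2 (N.src i)) with hamt
  have hfst : (N.greedyStep gB i).1 = Function.update gB.1 i amt := rfl
  have hsnd : ∀ v, (N.greedyStep gB i).2 v = gB.2 v + (if v = N.dest i then amt else 0)
      - (if v = N.src i ∧ N.src i ≠ N.s then amt else 0) := fun _ => rfl
  have hold : ∀ j ∈ P, Function.update gB.1 i amt j = gB.1 j := fun j hj =>
    Function.update_of_ne (ne_of_mem_of_not_mem hj hi) _ _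
  have hamt0 : 0 ≤ amt := by
    rw [hamt]
    split_ifs
    exacts [hq, le_min hq (hB0 _)]
  have hamtq : amt ≤ N.q i := by
    rw [hamt]
    split_ifs
    exacts [le_rfl, min_le_left _ _]
  have hamtB : N.src i ≠ N.s → amt ≤ gB.2 (N.src i) := fun hs => by
    rw [hamt, if_neg hs]
    exact min_le_right _ _
  have hin : ∀ v, N.inflow (insert i P) (Function.update gB.1 i amt) v =
      (if N.dest i = v then amt else 0) + N.inflow P gB.1 v := fun v => by
    rw [inflow_insert hi, inflow_congr hold, Function.update_self]
  have hout : ∀ v, N.outflow (insert i P) (Function.update gB.1 i amt) v =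
      (if N.src i = v then amt else 0) + N.outflow P gB.1 v := fun v => by
    rw [outflow_insert hi, outflow_congr hold, Function.update_self]
  constructor
  · intro v hv
    rw [hfst, hsnd, hin, hout, hB v hv]
    have hsv : (v = N.src i ∧ N.src i ≠ N.s) ↔ N.src i = v :=
      ⟨fun e => e.1.symm, fun e => ⟨e.symm, e ▸ hv⟩⟩
    rw [if_congr hsv rfl rfl, if_congr (eq_comm (a := v)) rfl rfl]
    ring
  · intro v
    rw [hsnd]
    have := hB0 v
    have hd : 0 ≤ if v = N.dest i then amt else 0 := by split_ifs <;> simp [hamt0]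
    by_cases hs : v = N.src i ∧ N.src i ≠ N.s
    · have := hamtB hs.2
      rw [← hs.1] at this
      rw [if_pos hs]
      linarith
    · rw [if_neg hs]
      linarith
  · rw [hfst, isFlow_restrict_insert hlt]
    refine ⟨hflow.congr fun j hj => (hold j hj).symm, ?_⟩
    simp only [Function.update_self, inflow_congr hold, outflow_congr hold]
    exact ⟨⟨hamt0, hamtq⟩, fun hs => if_pos hs, fun hs => hB _ hs ▸ hamtB hs⟩
  · intro x hx v
    obtain ⟨hxP, ⟨-, hxq⟩, hxs, hxb⟩ := (isFlow_restrict_insert hlt).1 hx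
    rw [hfst, hin, inflow_insert hi]
    have hv := hle x hxP v
    split_ifs with hd
    · subst hd
      by_cases hs : N.src i = N.s
      · rw [hamt, if_pos hs, hxs hs]
        linarith
      · rw [hamt, if_neg hs]
        have hx' := hxb hs
        have hg := hB _ hs
        rw [outflow_src_eq_inflow_dest hpar] at hx' hg
        have hsrc := hle x hxP (N.src i)
        rcases min_choice (N.q i) (gB.2 (N.src i)) with e | e <;> rw [e] <;> linarith
    · linarith

theorem GreedyInvariant.foldl (L : List ι) (hsorted : L.Pairwise fun a b => N.τ a < N.τ b)
    (hq : ∀ i ∈ L, 0 ≤ N.q i)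
    (hpar : ∀ i ∈ L, ∀ j ∈ L, N.src j = N.src i ↔ N.dest j = N.dest i) :
    N.GreedyInvariant L.toFinset (L.foldl N.greedyStep (fun _ => 0, fun _ => 0)) := by
  induction L using List.reverseRecOn with
  | nil =>
    constructor <;> simp [inflow, outflow, IsFlow, restrict]
  | append_singleton L i ih =>
    obtain ⟨hL, -, hlt⟩ := List.pairwise_append.1 hsorted
    have hmem : ∀ j ∈ L, j ∈ L ++ [i] := fun j hj => List.mem_append_left _ hj
    have hi : i ∈ L ++ [i] := List.mem_append_right _ (List.mem_singleton_self i)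
    have hset : (L ++ [i]).toFinset = insert i L.toFinset := by
      ext j
      simp
    rw [List.foldl_append, hset]
    exact (ih hL (fun j hj => hq j (hmem j hj))
      fun j hj l hl => hpar j (hmem j hj) l (hmem l hl)).step (hq i hi)
        (fun j hj => hlt j (List.mem_toFinset.1 hj) i (List.mem_singleton_self i))
        fun j hj => hpar i hi j (hmem j (List.mem_toFinset.1 hj))

theorem mem_sortedI : i ∈ N.sortedI ↔ i ∈ N.I := by
  simp [sortedI]

theorem pairwise_sortedI (hτ : ∀ i ∈ N.I, ∀ j ∈ N.I, N.τ i = N.τ j → i = j) :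
    N.sortedI.Pairwise fun a b => N.τ a < N.τ b := by
  have hle : N.sortedI.Pairwise fun a b => N.τ a ≤ N.τ b := by
    have := List.pairwise_mergeSort (le := fun a b => decide (N.τ a ≤ N.τ b))
      (fun a b c => by simpa using le_trans) (fun a b => by simpa using le_total _ _) N.I.toList
    simpa [sortedI] using this
  have hnd : N.sortedI.Nodup :=
    (List.mergeSort_perm _ _).nodup_iff.2 N.I.nodup_toList
  refine (hle.and hnd).imp_of_mem fun ha hb h => lt_of_le_of_ne h.1 fun e => ?_
  exact h.2 (hτ _ (mem_sortedI.1 ha) _ (mem_sortedI.1 hb) e)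

theorem IsChainNet.src_eq_iff_dest_eq (h : N.IsChainNet) {j : ι} (hi : i ∈ N.I) (hj : j ∈ N.I) :
    N.src j = N.src i ↔ N.dest j = N.dest i := by
  obtain ⟨k, -, v, hinj, -, -, -, -, hI⟩ := h
  obtain ⟨a, ha, hsa, hda⟩ := hI i hi
  obtain ⟨b, hb, hsb, hdb⟩ := hI j hj
  rw [hsa, hda, hsb, hdb]
  constructor
  · intro e
    rw [hinj b hb.le a ha.le e]
  · intro e
    rw [Nat.succ_injective (hinj (b + 1) hb (a + 1) ha e)]

end TIN

/-- On a chain, the greedy algorithm computes the maximum flow. -/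
theorem greedy_eq_maxFlow_of_chain (ν ι : Type) (N : TIN ν ι) (hN : N.Valid)
    (hchain : N.IsChainNet) :
    N.val N.greedy = N.maxFlow := by
  obtain ⟨-, -, -, hI, hτ⟩ := hN
  have hinv := TIN.GreedyInvariant.foldl N.sortedI (TIN.pairwise_sortedI hτ)
    (fun i hi => (hI i (TIN.mem_sortedI.1 hi)).2.2.2.1)
    fun i hi j hj => hchain.src_eq_iff_dest_eq (TIN.mem_sortedI.1 hi) (TIN.mem_sortedI.1 hj)
  have hset : N.sortedI.toFinset = N.I := by
    ext i
    rw [List.mem_toFinset, TIN.mem_sortedI]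
  rw [hset] at hinv
  have hgreatest : IsGreatest {r : ℝ | ∃ x, N.IsFlow x ∧ N.val x = r} (N.val N.greedy) := by
    refine ⟨⟨N.greedy, hinv.isFlow, rfl⟩, ?_⟩
    rintro _ ⟨x, hx, rfl⟩
    exact hinv.inflow_le x hx N.t
  exact hgreatest.csSup_eq.symm
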